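/- Let M be a semi-Gorenstein-projective left A-module. Then the following are equivalent: (i) M* is semi-Gorenstein-projective and the canonical map φ_M : M → M** is an epimorphism; (ii) (Ω M)* is semi-Gorenstein-projective. -/

import Mathlib

/-!
Common background: `A` is an artin algebra (an algebra over a commutative artinian
ring `k`, finitely generated as `k`-module).  Left `A`-modules are `Module A M`;
right `A`-modules are `Module Aᵐᵒᵖ N`.  `Dl A M = Hom_A(M,A)` is the `A`-dual of a
left module (a right module) and `Dr A N` the dual of a right module (a left module);
`evalL A M : M → M**` is the canonical evaluation map `φ_M`.
-/

open CategoryTheory LinearMap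

universe u

section Preliminaries

variable (A : Type u) [Ring A]

/-- The `A`-dual of a left `A`-module: `M* = Hom_A(M, A)`, a right `A`-module. -/
abbrev Dl (M : Type u) [AddCommGroup M] [Module A M] : Type u := M →ₗ[A] A

/-- The `A`-dual of a right `A`-module: a left `A`-module. -/
abbrev Dr (N : Type u) [AddCommGroup N] [Module Aᵐᵒᵖ N] : Type u := N →ₗ[Aᵐᵒᵖ] A

variable {A}

/-- The dual of a map of left modules. -/
def dualMapL {M N : Type u} [AddCommGroup M] [Module A M] [AddCommGroup N] [Module A N]
    (g : M →ₗ[A] N) : Dl A N →ₗ[Aᵐᵒᵖ] Dl A M where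
  toFun h := h.comp g
  map_add' h₁ h₂ := by ext; simp
  map_smul' a h := by ext; simp

/-- The dual of a map of right modules. -/
def dualMapR {M N : Type u} [AddCommGroup M] [Module Aᵐᵒᵖ M] [AddCommGroup N] [Module Aᵐᵒᵖ N]
    (g : M →ₗ[Aᵐᵒᵖ] N) : Dr A N →ₗ[A] Dr A M where
  toFun h := h.comp g
  map_add' h₁ h₂ := by ext; simp
  map_smul' a h := by ext; simp

variable (A)

/-- The canonical evaluation map `φ_M : M → M**` for a left module `M`. -/
def evalL (M : Type u) [AddCommGroup M] [Module A M] : M →ₗ[A] Dr A (Dl A M) where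
  toFun m :=
    { toFun := fun f => f m
      map_add' := fun f g => rfl
      map_smul' := fun a f => rfl }
  map_add' m m' := by ext f; simp
  map_smul' a m := by ext f; simp

/-- The canonical evaluation map `φ_N : N → N**` for a right module `N`. -/
def evalR (N : Type u) [AddCommGroup N] [Module Aᵐᵒᵖ N] : N →ₗ[Aᵐᵒᵖ] Dl A (Dr A N) where
  toFun n :=
    { toFun := fun f => f n
      map_add' := fun f g => rfl
      map_smul' := fun a f => rfl }
  map_add' n n' := by ext f; simp
  map_smul' a n := by ext f; simp

/-- The radical of a module: the intersection of all maximal submodules. -/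
def radM (M : Type u) [AddCommGroup M] [Module A M] : Submodule A M :=
  sInf {N : Submodule A M | IsCoatom N}

/-- A module is *reduced* if it has no nonzero projective direct summand. -/
def Reduced (M : Type u) [AddCommGroup M] [Module A M] : Prop :=
  ∀ N N' : Submodule A M, IsCompl N N' → Module.Projective A N → N = ⊥

/-- Vanishing of `Ext^i_A(M, N)`. -/
def extZero (M N : Type u) [AddCommGroup M] [Module A M] [AddCommGroup N] [Module A N]
    (i : ℕ) : Prop :=
  Limits.IsZero (((Ext ℤ (ModuleCat.{u} A) i).obj (Opposite.op (ModuleCat.of A M))).obj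
    (ModuleCat.of A N))

/-- A left module `M` is semi-Gorenstein-projective if `Ext^i_A(M, A) = 0` for all `i ≥ 1`. -/
def sGp (M : Type u) [AddCommGroup M] [Module A M] : Prop :=
  ∀ i : ℕ, 1 ≤ i → extZero A M A i

/-- Semi-Gorenstein-projectivity for right modules, with `A` as right regular module. -/
def sGpR (N : Type u) [AddCommGroup N] [Module Aᵐᵒᵖ N] : Prop :=
  ∀ i : ℕ, 1 ≤ i → extZero Aᵐᵒᵖ N A i

/-- `e : P → M` is a projective cover: `P` is a finitely generated projective module,
`e` is surjective and `ker e ⊆ rad P`. -/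
def IsProjCover {P M : Type u} [AddCommGroup P] [Module A P] [AddCommGroup M] [Module A M]
    (e : P →ₗ[A] M) : Prop :=
  Module.Projective A P ∧ Module.Finite A P ∧ Function.Surjective e ∧ ker e ≤ radM A P

/-- `P₁ →f P₀ →e M → 0` is a minimal projective presentation of `M`. -/
def IsMinPres {P₁ P₀ M : Type u} [AddCommGroup P₁] [Module A P₁] [AddCommGroup P₀] [Module A P₀]
    [AddCommGroup M] [Module A M] (f : P₁ →ₗ[A] P₀) (e : P₀ →ₗ[A] M) : Prop :=
  IsProjCover A e ∧ range f = ker e ∧ Module.Projective A P₁ ∧ Module.Finite A P₁ ∧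
    ker f ≤ radM A P₁

/-- A minimal projective resolution `⋯ → P₁ → P₀ → M → 0` (ℕ-indexed). -/
def IsMinProjRes (P : ℕ → Type u) [∀ n, AddCommGroup (P n)] [∀ n, Module A (P n)]
    {M : Type u} [AddCommGroup M] [Module A M]
    (f : ∀ n, P (n+1) →ₗ[A] P n) (e : P 0 →ₗ[A] M) : Prop :=
  (∀ n, Module.Projective A (P n)) ∧ (∀ n, Module.Finite A (P n)) ∧
    Function.Surjective e ∧ range (f 0) = ker e ∧ (∀ n, range (f (n+1)) = ker (f n)) ∧
    ker e ≤ radM A (P 0) ∧ (∀ n, ker (f n) ≤ radM A (P (n+1)))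

section ZComplex

variable (P : ℤ → Type u) [∀ i, AddCommGroup (P i)] [∀ i, Module A (P i)]
  (g : ∀ i : ℤ, P i →ₗ[A] P (i-1))

/-- `(P_i, g_i : P_i → P_{i-1})` is a complex. -/
def IsComplexZ : Prop := ∀ i : ℤ, (g (i-1)).comp (g i) = 0

/-- A complex is minimal if each image lies in the radical. -/
def IsMinimalZ : Prop := ∀ i : ℤ, range (g i) ≤ radM A (P (i-1))

/-- A complex of (finitely generated) projective modules. -/
def IsProjComplexZ : Prop := ∀ i : ℤ, Module.Projective A (P i) ∧ Module.Finite A (P i)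

/-- Exactness at position `i - 1`, i.e. `H_{i-1}(P_•) = 0`. -/
def ExactAtPred (i : ℤ) : Prop := range (g i) = ker (g (i-1))

/-- Acyclicity of the `A`-dual complex `P_•^*`. -/
def DualAcyclicZ : Prop :=
  ∀ i : ℤ, range (dualMapL (g (i-1))) = ker (dualMapL (g i))

/-- The homology of the complex at position `i - 1`. -/
abbrev HomologyAtPred (i : ℤ) : Type u :=
  ↥(ker (g (i-1))) ⧸ (Submodule.comap (ker (g (i-1))).subtype (range (g i)))

end ZComplex

/-- `Z` is (a representative of) the transpose `Tr M` of the left module `M`. -/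
def IsTrL (M : Type u) [AddCommGroup M] [Module A M]
    (Z : Type u) [AddCommGroup Z] [Module Aᵐᵒᵖ Z] : Prop :=
  ∃ (P₁ P₀ : ModuleCat.{u} A) (f : P₁ →ₗ[A] P₀) (e : P₀ →ₗ[A] M),
    IsMinPres A f e ∧ Nonempty (Z ≃ₗ[Aᵐᵒᵖ] (Dl A P₁ ⧸ range (dualMapL f)))

/-- `M` is (a representative of) the transpose `Tr Z` of the right module `Z`. -/
def IsTrR (Z : Type u) [AddCommGroup Z] [Module Aᵐᵒᵖ Z]
    (M : Type u) [AddCommGroup M] [Module A M] : Prop :=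
  ∃ (Q₁ Q₀ : ModuleCat.{u} Aᵐᵒᵖ) (d : Q₁ →ₗ[Aᵐᵒᵖ] Q₀) (c : Q₀ →ₗ[Aᵐᵒᵖ] Z),
    IsMinPres Aᵐᵒᵖ d c ∧ Nonempty (M ≃ₗ[A] (Dr A Q₁ ⧸ range (dualMapR d)))

/-- `W` is (a representative of) the syzygy `Ω M` of the left module `M`. -/
def IsSyzL (W M : Type u) [AddCommGroup W] [Module A W] [AddCommGroup M] [Module A M] : Prop :=
  ∃ (P : ModuleCat.{u} A) (e : P →ₗ[A] M),
    IsProjCover A e ∧ Nonempty (W ≃ₗ[A] ker e)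

/-- `W` is (a representative of) the syzygy `Ω Z` of the right module `Z`. -/
def IsSyzR (W Z : Type u) [AddCommGroup W] [Module Aᵐᵒᵖ W] [AddCommGroup Z] [Module Aᵐᵒᵖ Z] :
    Prop :=
  ∃ (Q : ModuleCat.{u} Aᵐᵒᵖ) (c : Q →ₗ[Aᵐᵒᵖ] Z),
    IsProjCover Aᵐᵒᵖ c ∧ Nonempty (W ≃ₗ[Aᵐᵒᵖ] ker c)

/-- `W` is a second syzygy `Ω² M`. -/
def IsSyz2L (W M : Type u) [AddCommGroup W] [Module A W] [AddCommGroup M] [Module A M] : Prop :=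
  ∃ (V : ModuleCat.{u} A), IsSyzL A V M ∧ IsSyzL A W V

/-- `W` is a second syzygy `Ω² Z` of a right module. -/
def IsSyz2R (W Z : Type u) [AddCommGroup W] [Module Aᵐᵒᵖ W] [AddCommGroup Z] [Module Aᵐᵒᵖ Z] :
    Prop :=
  ∃ (V : ModuleCat.{u} Aᵐᵒᵖ), IsSyzR A V Z ∧ IsSyzR A W V

/-- A right module `Z` is ∞-torsionfree if its transpose is semi-Gorenstein-projective. -/
def InfTfR (Z : Type u) [AddCommGroup Z] [Module Aᵐᵒᵖ Z] : Prop :=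
  ∃ (M : ModuleCat.{u} A), IsTrR A Z M ∧ sGp A M

/-- A left module `M` is ∞-torsionfree if its transpose is semi-Gorenstein-projective. -/
def InfTfL (M : Type u) [AddCommGroup M] [Module A M] : Prop :=
  ∃ (Z : ModuleCat.{u} Aᵐᵒᵖ), IsTrL A M Z ∧ sGpR A Z

/-- Projective dimension at most `n` (for objects of `ModuleCat A`). -/
def projDimLEcat : ℕ → ModuleCat.{u} A → Prop
  | 0, M => Module.Projective A M
  | (n+1), M => ∃ (P : ModuleCat.{u} A) (e : P →ₗ[A] M),
      Module.Projective A P ∧ Module.Finite A P ∧ Function.Surjective e ∧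
        projDimLEcat n (ModuleCat.of A (ker e))

/-- Projective dimension at most `n`. -/
def projDimLE (M : Type u) [AddCommGroup M] [Module A M] (n : ℕ) : Prop :=
  projDimLEcat A n (ModuleCat.of A M)

/-- A Nunke module: a semi-Gorenstein-projective module `M` with `M* = 0`. -/
def NunkeL (M : Type u) [AddCommGroup M] [Module A M] : Prop :=
  sGp A M ∧ ∀ f : Dl A M, f = 0

end Preliminaries


section ExtVanishing

/-- The derived-functor `Ext` of degree `n + 1` vanishes iff the `Ext`-group defined through the
derived category does. -/
lemma isZero_Ext_succ_iff_subsingleton {C : Type*} [Category* C] [Abelian C]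
    [EnoughProjectives C] [HasExt C] (X Y : C) (n : ℕ) :
    Limits.IsZero (((Ext ℤ C (n + 1)).obj (Opposite.op X)).obj Y) ↔
      Subsingleton (Abelian.Ext X Y (n + 1)) := by
  let R := ProjectiveResolution.of X
  rw [(R.isoExt (R := ℤ) (n + 1) Y).isZero_iff,
    ← HomologicalComplex.exactAt_iff_isZero_homology,
    HomologicalComplex.exactAt_iff' _ n (n + 1) (n + 2) (by simp) (by simp),
    ShortComplex.moduleCat_exact_iff]
  constructor
  · intro h
    refine subsingleton_of_forall_eq 0 fun α => ?_
    obtain ⟨f, hf, rfl⟩ := R.extMk_surjective α (n + 2) rfl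
    rw [R.extMk_eq_zero_iff f _ rfl hf n rfl]
    exact h f hf
  · intro h f hf
    exact (R.extMk_eq_zero_iff f (n + 2) rfl hf n rfl).1 (Subsingleton.elim _ _)

variable {A : Type u} [Ring A]

lemma extZero_succ_iff (M N : Type u) [AddCommGroup M] [Module A M] [AddCommGroup N] [Module A N]
    (n : ℕ) : extZero A M N (n + 1) ↔
      Subsingleton (Abelian.Ext (ModuleCat.of A M) (ModuleCat.of A N) (n + 1)) :=
  isZero_Ext_succ_iff_subsingleton _ _ n

variable {X Q Y : Type u} [AddCommGroup X] [Module A X] [AddCommGroup Q] [Module A Q]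
  [AddCommGroup Y] [Module A Y] {f : X →ₗ[A] Q} {g : Q →ₗ[A] Y}

lemma exists_shortExact_of_exact (hf : Function.Injective f) (hfg : Function.Exact f g)
    (hg : Function.Surjective g) :
    ∃ w, (ShortComplex.mk (ModuleCat.ofHom f) (ModuleCat.ofHom g) w).ShortExact := by
  refine ⟨by ext x; exact hfg.apply_apply_eq_zero x, .mk' ?_ ?_ ?_⟩
  · rw [ShortComplex.moduleCat_exact_iff]
    exact fun x hx => (hfg x).1 hx
  · exact (ModuleCat.mono_iff_injective _).2 hf
  · exact (ModuleCat.epi_iff_surjective _).2 hg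

/-- Given a short exact sequence `0 → X → Q → Y → 0` with `Q` projective, `Ext¹(Y, N) = 0` iff
every map `X → N` extends to `Q`. -/
lemma extZero_one_iff_forall_extends [Module.Projective A Q] (hf : Function.Injective f)
    (hfg : Function.Exact f g) (hg : Function.Surjective g)
    (N : Type u) [AddCommGroup N] [Module A N] :
    extZero A Y N 1 ↔ ∀ h : X →ₗ[A] N, ∃ h' : Q →ₗ[A] N, h' ∘ₗ f = h := by
  obtain ⟨w, hS⟩ := exists_shortExact_of_exact hf hfg hg
  have : Projective (ModuleCat.of A Q) :=
    (ModuleCat.of A Q).projective_of_categoryTheory_projective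
  rw [extZero_succ_iff Y N 0]
  constructor
  · intro _ h
    obtain ⟨x, hx⟩ := Abelian.Ext.contravariant_sequence_exact₁ hS (ModuleCat.of A N)
      (Abelian.Ext.mk₀ (ModuleCat.ofHom h)) (n₁ := 0 + 1) rfl
      (Subsingleton.elim (α := Abelian.Ext (ModuleCat.of A Y) _ (0 + 1)) _ _)
    obtain ⟨h', rfl⟩ := (Abelian.Ext.mk₀_bijective _ _).2 x
    rw [Abelian.Ext.mk₀_comp_mk₀] at hx
    exact ⟨h'.hom, congrArg ModuleCat.Hom.hom ((Abelian.Ext.mk₀_bijective _ _).1 hx)⟩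
  · intro h
    refine subsingleton_of_forall_eq 0 fun α => ?_
    obtain ⟨x, rfl⟩ := Abelian.Ext.contravariant_sequence_exact₃ hS (ModuleCat.of A N) α
      (Abelian.Ext.eq_zero_of_projective _) (n₀ := 0) rfl
    obtain ⟨h₁, rfl⟩ := (Abelian.Ext.mk₀_bijective _ _).2 x
    obtain ⟨h', hh'⟩ := h h₁.hom
    have : h₁ = ModuleCat.ofHom f ≫ ModuleCat.ofHom h' := by
      ext x
      exact (LinearMap.congr_fun hh' x).symm
    rw [this, ← Abelian.Ext.mk₀_comp_mk₀]
    exact hS.extClass_comp_assoc _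

/-- Dimension shifting along a short exact sequence `0 → X → Q → Y → 0` with `Q` projective. -/
lemma extZero_add_two_iff [Module.Projective A Q] (hf : Function.Injective f)
    (hfg : Function.Exact f g) (hg : Function.Surjective g)
    (N : Type u) [AddCommGroup N] [Module A N] (n : ℕ) :
    extZero A Y N (n + 2) ↔ extZero A X N (n + 1) := by
  obtain ⟨w, hS⟩ := exists_shortExact_of_exact hf hfg hg
  have : Projective (ModuleCat.of A Q) :=
    (ModuleCat.of A Q).projective_of_categoryTheory_projective
  rw [extZero_succ_iff Y N (n + 1), extZero_succ_iff X N n]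
  constructor
  · intro _
    refine subsingleton_of_forall_eq 0 fun α => ?_
    obtain ⟨x, hx⟩ := Abelian.Ext.contravariant_sequence_exact₁ hS (ModuleCat.of A N) α
      (n₁ := n + 1 + 1) (by lia)
      (Subsingleton.elim (α := Abelian.Ext (ModuleCat.of A Y) _ (n + 1 + 1)) _ _)
    have : x = 0 := Abelian.Ext.eq_zero_of_projective _
    rw [← hx, this, Abelian.Ext.comp_zero]
  · intro _
    refine subsingleton_of_forall_eq 0 fun α => ?_
    obtain ⟨x, rfl⟩ := Abelian.Ext.contravariant_sequence_exact₃ hS (ModuleCat.of A N) α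
      (Abelian.Ext.eq_zero_of_projective _)
      (n₀ := n + 1) (by lia)
    have : x = 0 := Subsingleton.elim (α := Abelian.Ext (ModuleCat.of A X) _ (n + 1)) _ _
    rw [this, Abelian.Ext.comp_zero]

end ExtVanishing

section Duality

variable {A : Type u} [Ring A]

lemma exists_dual_basis (P : Type u) [AddCommGroup P] [Module A P] [Module.Projective A P]
    [Module.Finite A P] : ∃ (n : ℕ) (e : Fin n → P) (c : Fin n → Dl A P),
      ∀ h : Dl A P, ∑ i, MulOpposite.op (h (e i)) • c i = h := by
  obtain ⟨n, f, g, -, -, hfg⟩ := Module.Finite.exists_comp_eq_id_of_projective A P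
  refine ⟨n, fun i => f (Pi.single i 1), fun i => LinearMap.proj i ∘ₗ g, fun h => ?_⟩
  ext p
  have hp : f (g p) = p := LinearMap.congr_fun hfg p
  have hg : g p = ∑ i, g p i • Pi.single i (1 : A) := pi_eq_sum_univ' (g p)
  conv_rhs => rw [← hp, hg]
  simp

lemma projective_dual (P : Type u) [AddCommGroup P] [Module A P] [Module.Projective A P]
    [Module.Finite A P] : Module.Projective Aᵐᵒᵖ (Dl A P) := by
  obtain ⟨n, e, c, hc⟩ := exists_dual_basis (A := A) P
  let i : Dl A P →ₗ[Aᵐᵒᵖ] (Fin n → Aᵐᵒᵖ) :=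
    { toFun := fun h j => MulOpposite.op (h (e j))
      map_add' := fun _ _ => rfl
      map_smul' := fun _ _ => rfl }
  refine Module.Projective.of_split i (Fintype.linearCombination Aᵐᵒᵖ c) ?_
  ext1 h
  exact hc h

lemma evalL_surjective_of_projective (P : Type u) [AddCommGroup P] [Module A P]
    [Module.Projective A P] [Module.Finite A P] : Function.Surjective (evalL A P) := by
  intro ψ
  obtain ⟨n, e, c, hc⟩ := exists_dual_basis (A := A) P
  refine ⟨∑ i, ψ (c i) • e i, ?_⟩
  ext h
  change h _ = ψ h
  conv_rhs => rw [← hc h]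
  simp

variable {X Q Y : Type u} [AddCommGroup X] [Module A X] [AddCommGroup Q] [Module A Q]
  [AddCommGroup Y] [Module A Y] {f : X →ₗ[A] Q} {g : Q →ₗ[A] Y}

lemma dualMapL_injective (hg : Function.Surjective g) : Function.Injective (dualMapL g) :=
  fun _ _ h => (LinearMap.cancel_right hg).1 h

lemma dualMapL_exact (hfg : Function.Exact f g) (hg : Function.Surjective g) :
    Function.Exact (dualMapL g) (dualMapL f) := by
  intro h
  constructor
  · intro hh
    have hk : ker g ≤ ker h := by
      intro q hq
      obtain ⟨x, rfl⟩ := (hfg q).1 hq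
      exact LinearMap.congr_fun hh x
    refine ⟨(ker g).liftQ h hk ∘ₗ (g.quotKerEquivOfSurjective hg).symm, ?_⟩
    ext q
    change (ker g).liftQ h hk ((g.quotKerEquivOfSurjective hg).symm (g q)) = h q
    have : (g.quotKerEquivOfSurjective hg).symm (g q) = (ker g).mkQ q := by
      rw [LinearEquiv.symm_apply_eq]
      rfl
    rw [this]
    rfl
  · rintro ⟨l, rfl⟩
    ext x
    change l (g (f x)) = 0
    rw [hfg.apply_apply_eq_zero, map_zero]

/-- For a surjection `Q → Y` from a finitely generated projective module, `φ_Y` is surjective iff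
`Q** → Y**` is. -/
lemma evalL_surjective_iff [Module.Projective A Q] [Module.Finite A Q]
    (hg : Function.Surjective g) :
    Function.Surjective (evalL A Y) ↔ Function.Surjective (dualMapR (dualMapL g)) := by
  have hcomm : ⇑(dualMapR (dualMapL g)) ∘ evalL A Q = evalL A Y ∘ g := rfl
  rw [← (evalL_surjective_of_projective (A := A) Q).of_comp_iff, hcomm, hg.of_comp_iff]

end Duality

/-- Proposition 3.1(1): for a semi-Gorenstein-projective `M`, the dual `M^*` is
semi-Gorenstein-projective with `φ_M` an epimorphism iff `(Ω M)^*` is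
semi-Gorenstein-projective. -/
theorem dual_sgp_and_phi_epi_iff_syzygy_dual_sgp (k : Type u) [CommRing k] [IsArtinianRing k]
    (A : Type u) [Ring A] [Algebra k A] [Module.Finite k A]
    (M : Type u) [AddCommGroup M] [Module A M] [Module.Finite A M] (hM : sGp A M)
    (W : ModuleCat.{u} A) (hW : IsSyzL A (↥W) M) :
    (sGpR A (Dl A M) ∧ Function.Surjective (evalL A M)) ↔ sGpR A (Dl A (↥W)) := by
  obtain ⟨P, e, ⟨_, _, he, -⟩, ⟨w⟩⟩ := hW
  let f : W →ₗ[A] P := (ker e).subtype ∘ₗ w.toLinearMap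
  have hf : Function.Injective f := (ker e).injective_subtype.comp w.injective
  have hfe : Function.Exact f e := by
    rw [LinearMap.exact_iff, LinearMap.range_comp_of_range_eq_top _ w.range,
      Submodule.range_subtype]
  have hd : Function.Surjective (dualMapL f) :=
    (extZero_one_iff_forall_extends hf hfe he A).1 (hM 1 le_rfl)
  have hi := dualMapL_injective he
  have hx := dualMapL_exact hfe he
  have := projective_dual (A := A) P
  have key : Function.Surjective (evalL A M) ↔ extZero Aᵐᵒᵖ (Dl A W) A 1 :=
    (evalL_surjective_iff he).trans (extZero_one_iff_forall_extends hi hx hd A).symm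
  rw [key]
  constructor
  · rintro ⟨h, h₁⟩ (_ | _ | n) hn
    · lia
    · exact h₁
    · exact (extZero_add_two_iff hi hx hd A n).2 (h (n + 1) (by lia))
  · refine fun h => ⟨?_, h 1 le_rfl⟩
    rintro (_ | n) hn
    · lia
    · exact (extZero_add_two_iff hi hx hd A n).1 (h (n + 2) (by lia))
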